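/- A locally integrable function φ : [0,∞) → ℝ is translation uniform integrable in L¹_loc([0,∞)) if and only if for every sequence (τ_n)_{n≥1} ⊂ [0,∞) there exist a strictly increasing sequence of indices (n_k)_{k≥1} and a locally integrable function g : [0,∞) → ℝ such that the shifts φ(·+τ_{n_k}) converge weakly to g in L¹_loc([0,∞)); that is, for every T > 0 and every bounded measurable ψ : [0,T] → ℝ, ∫₀^T φ(t+τ_{n_k}) ψ(t) dt → ∫₀^T g(t) ψ(t) dt as k → ∞. -/

import Mathlib

open MeasureTheory Filter

/-- Translation uniform integrability in `L¹_loc([0,∞))`. -/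
def TransUnifInt (φ : ℝ → ℝ) : Prop :=
  ∀ ε > (0 : ℝ), ∃ K₀ : ℝ, ∀ K ≥ K₀, ∀ t : ℝ, 0 ≤ t →
    (∫ s in t..(t + 1), (if K ≤ |φ s| then |φ s| else 0)) ≤ ε

/-- Equi-absolute continuity of the integrals of a family of functions. -/
def EquiAbsCont {α ι : Type*} [MeasurableSpace α] (μ : Measure α) (f : ι → α → ℝ) : Prop :=
  ∀ ε > (0 : ℝ), ∃ δ > (0 : ℝ), ∀ i, ∀ A, MeasurableSet A → μ.real A ≤ δ →
    ∫ x in A, |f i x| ∂μ ≤ ε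

theorem exists_forall_setIntegral_abs_le {α : Type*} [MeasurableSpace α] {μ : Measure α}
    [IsFiniteMeasure μ] {f : α → ℝ} (hf : Integrable f μ) {ε : ℝ} (hε : 0 < ε) :
    ∃ δ > (0 : ℝ), ∀ A, MeasurableSet A → μ.real A ≤ δ → ∫ x in A, |f x| ∂μ ≤ ε := by
  obtain ⟨δ, hδ, h⟩ := (memLp_one_iff_integrable.2 hf).eLpNorm_indicator_le le_rfl
    ENNReal.one_ne_top hε
  refine ⟨δ, hδ, fun A hA hAδ => ?_⟩
  have h1 := h A hA (by
    rw [← ofReal_measureReal]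
    exact ENNReal.ofReal_le_ofReal hAδ)
  rw [eLpNorm_indicator_eq_eLpNorm_restrict hA, eLpNorm_one_eq_lintegral_enorm,
    ← ofReal_integral_norm_eq_lintegral_enorm hf.integrableOn] at h1
  exact (ENNReal.ofReal_le_ofReal_iff hε.le).1 h1

theorem integrable_ite_le_abs {α : Type*} [MeasurableSpace α] {μ : Measure α} {f : α → ℝ}
    (hf : Integrable f μ) (K : ℝ) : Integrable (fun x => if K ≤ |f x| then |f x| else 0) μ := by
  have hm : Measurable (fun y : ℝ => if K ≤ |y| then |y| else 0) :=
    Measurable.ite (measurableSet_le measurable_const measurable_abs) measurable_abs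
      measurable_const
  refine hf.mono (hm.comp_aemeasurable hf.aemeasurable).aestronglyMeasurable
    (Eventually.of_forall fun x => ?_)
  split_ifs <;> simp

theorem setIntegral_abs_le_of_tail_le {α : Type*} [MeasurableSpace α] {μ : Measure α}
    [IsFiniteMeasure μ] {f : α → ℝ} (hf : Integrable f μ) {ε K : ℝ} (hK : 0 ≤ K)
    (h : ∫ x, (if K ≤ |f x| then |f x| else 0) ∂μ ≤ ε) (A : Set α) :
    ∫ x in A, |f x| ∂μ ≤ ε + K * μ.real A := by
  have hi := integrable_ite_le_abs hf K
  calc ∫ x in A, |f x| ∂μ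
      ≤ ∫ x in A, ((if K ≤ |f x| then |f x| else 0) + K) ∂μ := by
        refine integral_mono hf.abs.integrableOn (hi.integrableOn.add (integrable_const K))
          fun x => ?_
        dsimp only
        split_ifs with hx
        · linarith
        · linarith [not_le.1 hx]
    _ = ∫ x in A, (if K ≤ |f x| then |f x| else 0) ∂μ + K * μ.real A := by
        rw [integral_add hi.integrableOn (integrable_const K)]
        simp [mul_comm]
    _ ≤ ε + K * μ.real A := by
        gcongr
        refine (setIntegral_le_integral hi (Eventually.of_forall fun x => ?_)).trans h
        dsimp only
        split_ifs <;> simp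

theorem equiAbsCont_of_tail_le {α ι : Type*} [MeasurableSpace α] {μ : Measure α}
    [IsFiniteMeasure μ] {f : ι → α → ℝ} (hf : ∀ i, Integrable (f i) μ)
    (h : ∀ ε > (0 : ℝ), ∃ K ≥ (0 : ℝ), ∀ i, ∫ x, (if K ≤ |f i x| then |f i x| else 0) ∂μ ≤ ε) :
    EquiAbsCont μ f := by
  intro ε hε
  obtain ⟨K, hK, hKi⟩ := h (ε / 2) (by positivity)
  refine ⟨ε / 2 / (K + 1), by positivity, fun i A _ hA => ?_⟩
  refine (setIntegral_abs_le_of_tail_le (hf i) hK (hKi i) A).trans ?_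
  have h2 : K * μ.real A ≤ (K + 1) * (ε / 2 / (K + 1)) := by gcongr; linarith
  rw [mul_div_cancel₀ _ (by positivity)] at h2
  linarith

theorem EquiAbsCont.tendsto_setIntegral_iUnion {α : Type*} [MeasurableSpace α] {μ : Measure α}
    [IsFiniteMeasure μ] {f : ℕ → α → ℝ} {g : α → ℝ} (hE : EquiAbsCont μ f)
    (hf : ∀ n, Integrable (f n) μ) (hg : Integrable g μ) {A : ℕ → Set α}
    (hd : Pairwise (Function.onFun Disjoint A)) (hA : ∀ i, MeasurableSet (A i))
    (h : ∀ i, Tendsto (fun n => ∫ x in A i, f n x ∂μ) atTop (nhds (∫ x in A i, g x ∂μ))) :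
    Tendsto (fun n => ∫ x in ⋃ i, A i, f n x ∂μ) atTop (nhds (∫ x in ⋃ i, A i, g x ∂μ)) := by
  refine TendstoUniformly.tendsto_of_eventually_tendsto
    (F := fun N n => ∑ i ∈ Finset.range N, ∫ x in A i, f n x ∂μ) (p := atTop)
    (L := fun N => ∑ i ∈ Finset.range N, ∫ x in A i, g x ∂μ) ?_
    (Eventually.of_forall fun N => tendsto_finsetSum _ fun i _ => h i)
    (hasSum_integral_iUnion hA hd hg.integrableOn).tendsto_sum_nat
  have hm := (hasSum_integral_iUnion (f := fun _ => (1 : ℝ)) (μ := μ) hA hd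
    (integrable_const _)).tendsto_sum_nat
  simp only [integral_const, smul_eq_mul, mul_one, measureReal_restrict_apply_univ] at hm
  rw [Metric.tendstoUniformly_iff]
  intro ε hε
  obtain ⟨δ, hδ, hδf⟩ := hE (ε / 2) (by positivity)
  filter_upwards [Metric.tendsto_atTop'.1 hm δ hδ |>.elim fun N hN => eventually_gt_atTop N |>.mono
    fun n hn => hN n hn] with N hN n
  have hB : MeasurableSet (⋃ i ∈ Finset.range N, A i) :=
    Finset.measurableSet_biUnion _ fun i _ => hA i
  have hsub : (⋃ i ∈ Finset.range N, A i) ⊆ ⋃ i, A i :=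
    Set.iUnion₂_subset fun i _ => Set.subset_iUnion A i
  have key : ∀ u : α → ℝ, Integrable u μ →
      ∫ x in (⋃ i, A i) \ ⋃ i ∈ Finset.range N, A i, u x ∂μ =
        ∫ x in ⋃ i, A i, u x ∂μ - ∑ i ∈ Finset.range N, ∫ x in A i, u x ∂μ := by
    intro u hu
    rw [setIntegral_sdiff hB hu.integrableOn hsub, integral_biUnion_finset _ (fun i _ => hA i)
      (fun i _ j _ hij => hd hij) fun i _ => hu.integrableOn]
  have h1 := key (fun _ => 1) (integrable_const _)
  simp only [integral_const, smul_eq_mul, mul_one, measureReal_restrict_apply_univ] at h1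
  rw [Real.dist_eq, ← key _ (hf n)]
  refine (abs_integral_le_integral_abs.trans (hδf n _ ((MeasurableSet.iUnion hA).diff hB) ?_)).trans_lt
    (by linarith)
  rw [h1]
  rw [Real.dist_eq, abs_sub_comm] at hN
  exact (le_abs_self _).trans hN.le

theorem EquiAbsCont.tendsto_setIntegral_of_generateFrom {α : Type*} [m : MeasurableSpace α]
    {μ : Measure α} [IsFiniteMeasure μ] {f : ℕ → α → ℝ} {g : α → ℝ} (hE : EquiAbsCont μ f)
    (hf : ∀ n, Integrable (f n) μ) (hg : Integrable g μ) {S : Set (Set α)}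
    (hS : m = MeasurableSpace.generateFrom S) (hpi : IsPiSystem S)
    (huniv : Tendsto (fun n => ∫ x, f n x ∂μ) atTop (nhds (∫ x, g x ∂μ)))
    (h : ∀ A ∈ S, Tendsto (fun n => ∫ x in A, f n x ∂μ) atTop (nhds (∫ x in A, g x ∂μ)))
    {A : Set α} (hA : MeasurableSet A) :
    Tendsto (fun n => ∫ x in A, f n x ∂μ) atTop (nhds (∫ x in A, g x ∂μ)) := by
  induction A, hA using MeasurableSpace.induction_on_inter hS hpi with
  | empty => simp
  | basic t ht => exact h t ht
  | compl t htm ih =>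
    simp only [fun n => setIntegral_compl htm (hf n), setIntegral_compl htm hg]
    exact huniv.sub ih
  | iUnion B hd hB ih => exact hE.tendsto_setIntegral_iUnion hf hg hd hB ih

theorem exists_simpleFunc_abs_sub_le {α : Type*} [MeasurableSpace α] {ψ : α → ℝ}
    (hψ : Measurable ψ) {C : ℝ} (hC : ∀ x, |ψ x| ≤ C) {ε : ℝ} (hε : 0 < ε) :
    ∃ s : SimpleFunc α ℝ, ∀ x, |s x - ψ x| ≤ ε := by
  have hm : Measurable fun x => ε * (⌊ψ x / ε⌋ : ℝ) :=
    measurable_const.mul ((measurable_from_top (f := fun z : ℤ => (z : ℝ))).comp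
      (Int.measurable_floor.comp (hψ.div_const ε)))
  refine ⟨⟨fun x => ε * (⌊ψ x / ε⌋ : ℝ), fun y => hm (measurableSet_singleton y), ?_⟩,
    fun x => ?_⟩
  · refine ((Set.finite_Icc ⌊-C / ε⌋ ⌊C / ε⌋).image fun z : ℤ => ε * (z : ℝ)).subset ?_
    rintro _ ⟨x, rfl⟩
    have := abs_le.1 (hC x)
    exact ⟨⌊ψ x / ε⌋, ⟨Int.floor_le_floor (by gcongr; exact this.1),
      Int.floor_le_floor (by gcongr; exact this.2)⟩, rfl⟩
  · change |ε * (⌊ψ x / ε⌋ : ℝ) - ψ x| ≤ ε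
    have h1 := Int.floor_le (ψ x / ε)
    have h2 := (Int.lt_floor_add_one (ψ x / ε)).le
    have h3 : ε * (ψ x / ε) = ψ x := mul_div_cancel₀ _ hε.ne'
    rw [abs_le]
    constructor <;> nlinarith

theorem tendsto_integral_mul_of_tendsto_setIntegral {α : Type*} [MeasurableSpace α]
    {μ : Measure α} {f : ℕ → α → ℝ} {g : α → ℝ}
    (hf : ∀ n, Integrable (f n) μ) (hg : Integrable g μ) {M : ℝ} (hM : ∀ n, ∫ x, |f n x| ∂μ ≤ M)
    (h : ∀ A, MeasurableSet A →
      Tendsto (fun n => ∫ x in A, f n x ∂μ) atTop (nhds (∫ x in A, g x ∂μ)))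
    {ψ : α → ℝ} (hψ : Measurable ψ) {C : ℝ} (hC : ∀ x, |ψ x| ≤ C) :
    Tendsto (fun n => ∫ x, f n x * ψ x ∂μ) atTop (nhds (∫ x, g x * ψ x ∂μ)) := by
  have hsi : ∀ (s : SimpleFunc α ℝ) (u : α → ℝ), Integrable u μ →
      Integrable (fun x => u x * s x) μ := fun s u hu => by
    obtain ⟨c, hc⟩ := s.exists_forall_norm_le
    exact hu.mul_bdd (c := c) s.measurable.aestronglyMeasurable (Eventually.of_forall hc)
  have hsimple : ∀ s : SimpleFunc α ℝ,
      Tendsto (fun n => ∫ x, f n x * s x ∂μ) atTop (nhds (∫ x, g x * s x ∂μ)) := by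
    intro s
    induction s using SimpleFunc.induction with
    | @const c A hA =>
      have : ∀ u : α → ℝ, ∫ x, u x * (SimpleFunc.piecewise A hA (SimpleFunc.const α c)
          (SimpleFunc.const α 0)) x ∂μ = (∫ x in A, u x ∂μ) * c := by
        intro u
        rw [← integral_mul_const, ← integral_indicator hA]
        congr 1 with x
        by_cases hx : x ∈ A <;> simp [hx]
      simp only [this]
      exact (h A hA).mul_const c
    | @add s t _ hs ht =>
      have : ∀ u : α → ℝ, Integrable u μ → ∫ x, u x * (s + t) x ∂μ =
          ∫ x, u x * s x ∂μ + ∫ x, u x * t x ∂μ := by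
        intro u hu
        rw [← integral_add (hsi s u hu) (hsi t u hu)]
        simp [mul_add]
      simp only [fun n => this _ (hf n), this g hg]
      exact hs.add ht
  choose s hs using fun j : ℕ =>
    exists_simpleFunc_abs_sub_le hψ hC (ε := 1 / ((j : ℝ) + 1)) (by positivity)
  have hest : ∀ (j : ℕ) (u : α → ℝ), Integrable u μ →
      |∫ x, u x * ψ x ∂μ - ∫ x, u x * s j x ∂μ| ≤ (∫ x, |u x| ∂μ) * (1 / ((j : ℝ) + 1)) := by
    intro j u hu
    rw [← integral_sub (hu.mul_bdd (c := C) hψ.aestronglyMeasurable (Eventually.of_forall hC))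
      (hsi _ _ hu), ← integral_mul_const]
    refine abs_integral_le_integral_abs.trans (integral_mono_of_nonneg
      (Eventually.of_forall fun x => abs_nonneg _) (hu.abs.mul_const _)
      (Eventually.of_forall fun x => ?_))
    dsimp only
    rw [← mul_sub, abs_mul, abs_sub_comm]
    gcongr
    exact hs j x
  have hlim : ∀ M : ℝ, Tendsto (fun j : ℕ => M * (1 / ((j : ℝ) + 1))) atTop (nhds 0) := fun M => by
    simpa using tendsto_one_div_add_atTop_nhds_zero_nat.const_mul M
  refine TendstoUniformly.tendsto_of_eventually_tendsto
    (F := fun j n => ∫ x, f n x * s j x ∂μ) (p := atTop)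
    (L := fun j => ∫ x, g x * s j x ∂μ) ?_ (Eventually.of_forall fun j => hsimple (s j)) ?_
  · rw [Metric.tendstoUniformly_iff]
    intro ε hε
    filter_upwards [(hlim M).eventually_lt_const hε] with j hj n
    rw [Real.dist_eq]
    exact ((hest j _ (hf n)).trans (by gcongr; exact hM n)).trans_lt hj
  · rw [tendsto_iff_dist_tendsto_zero]
    refine squeeze_zero (fun _ => dist_nonneg) (fun j => ?_) (hlim (∫ x, |g x| ∂μ))
    rw [Real.dist_eq, abs_sub_comm]
    exact hest j g hg

theorem exists_subseq_tendsto_integral_mul {α : Type*} [MeasurableSpace α] {μ : Measure α}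
    {h : ℕ → Lp ℝ 1 μ} {h₀ : Lp ℝ 1 μ} (hh : Tendsto h atTop (nhds h₀))
    (hb : ∀ n, ∀ᵐ x ∂μ, |h n x| ≤ 1) :
    (∀ᵐ x ∂μ, |h₀ x| ≤ 1) ∧ ∃ ns : ℕ → ℕ, ∀ u : α → ℝ, Integrable u μ →
      Tendsto (fun n => ∫ x, u x * h (ns n) x ∂μ) atTop (nhds (∫ x, u x * h₀ x ∂μ)) := by
  obtain ⟨ns, -, hns⟩ := (tendstoInMeasure_of_tendsto_Lp hh).exists_seq_tendsto_ae
  have hb' := ae_all_iff.2 hb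
  refine ⟨?_, ns, fun u hu => ?_⟩
  · filter_upwards [hns, hb'] with x hx hbx
    exact le_of_tendsto hx.abs (Eventually.of_forall fun n => hbx _)
  · refine tendsto_integral_of_dominated_convergence (fun x => |u x|)
      (fun n => hu.1.mul (Lp.aestronglyMeasurable _)) hu.abs (fun n => ?_) ?_
    · filter_upwards [hb (ns n)] with x hx
      rw [norm_mul, Real.norm_eq_abs, Real.norm_eq_abs]
      exact mul_le_of_le_one_right (abs_nonneg _) hx
    · filter_upwards [hns] with x hx
      exact hx.const_mul _

/-- A form of the Vitali–Hahn–Saks theorem. -/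
theorem exists_equiAbsCont_tail_of_cauchySeq {α : Type*} [MeasurableSpace α] {μ : Measure α}
    [IsFiniteMeasure μ] {f : ℕ → α → ℝ} (hf : ∀ n, Integrable (f n) μ)
    (hc : ∀ ψ : α → ℝ, Measurable ψ → (∀ x, |ψ x| ≤ 1) →
      CauchySeq fun n => ∫ x, f n x * ψ x ∂μ) {ε : ℝ} (hε : 0 < ε) :
    ∃ k₀, ∃ δ > (0 : ℝ), ∀ k ≥ k₀, ∀ B, MeasurableSet B → μ.real B ≤ δ →
      ∫ x in B, |f k x - f k₀ x| ∂μ ≤ ε := by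
  classical
  let X : Set (Lp ℝ 1 μ) := {h | ∀ᵐ x ∂μ, |h x| ≤ 1}
  have hX : IsClosed X := IsSeqClosed.isClosed fun h h₀ hh hlim =>
    (exists_subseq_tendsto_integral_mul hlim hh).1
  have hmul : ∀ {u h : α → ℝ}, Integrable u μ → AEStronglyMeasurable h μ →
      (∀ᵐ x ∂μ, |h x| ≤ 1) → Integrable (fun x => u x * h x) μ := fun hu hm hb =>
    hu.mul_bdd (c := 1) hm hb
  let E : ℕ → Set X := fun k₀ =>
    {h | ∀ k ≥ k₀, |∫ x, (f k x - f k₀ x) * h.1 x ∂μ| ≤ ε / 2}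
  have hE : ∀ k₀, IsClosed (E k₀) := fun k₀ => IsSeqClosed.isClosed fun h h₀ hh hlim => by
    obtain ⟨-, ns, hns⟩ := exists_subseq_tendsto_integral_mul
      ((continuous_subtype_val.tendsto h₀).comp hlim) fun n => (h n).2
    intro k hk
    exact le_of_tendsto (hns _ ((hf k).sub (hf k₀))).abs
      (Eventually.of_forall fun n => hh (ns n) k hk)
  have hU : ⋃ k₀, E k₀ = Set.univ := by
    refine Set.eq_univ_of_forall fun h => Set.mem_iUnion.2 ?_
    have hψ := hc (fun x => max (-1) (min 1 (h.1 x)))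
      (measurable_const.max (measurable_const.min (Lp.stronglyMeasurable h.1).measurable))
      fun x => abs_le.2 ⟨le_max_left _ _, max_le (by norm_num) (min_le_left _ _)⟩
    obtain ⟨k₀, hk₀⟩ := Metric.cauchySeq_iff'.1 hψ (ε / 2) (by positivity)
    refine ⟨k₀, fun k hk => ?_⟩
    have heq : ∀ n, ∫ x, f n x * max (-1) (min 1 (h.1 x)) ∂μ = ∫ x, f n x * h.1 x ∂μ := by
      intro n
      refine integral_congr_ae ?_
      filter_upwards [h.2] with x hx
      rw [abs_le] at hx
      rw [min_eq_right hx.2, max_eq_right hx.1]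
    have := hk₀ k hk
    rw [heq, heq, Real.dist_eq, ← integral_sub (hmul (hf k) (Lp.aestronglyMeasurable _) h.2)
      (hmul (hf k₀) (Lp.aestronglyMeasurable _) h.2)] at this
    simp only [sub_mul]
    exact this.le
  have : CompleteSpace X := hX.completeSpace_coe
  have : Nonempty X := ⟨⟨0, by
    filter_upwards [Lp.coeFn_zero ℝ 1 μ] with x hx
    rw [hx]
    simp⟩⟩
  obtain ⟨k₀, h₀, hh₀⟩ := nonempty_interior_of_iUnion_of_closed hE hU
  obtain ⟨r, hr, hball⟩ := Metric.isOpen_iff.1 isOpen_interior h₀ hh₀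
  refine ⟨k₀, r / 4, by positivity, fun k hk B hB hBr => ?_⟩
  have hd : Integrable (fun x => f k x - f k₀ x) μ := (hf k).sub (hf k₀)
  have hmem : ∀ v : α → ℝ, AEStronglyMeasurable v μ → (∀ x, |v x| ≤ 1) →
      |∫ x, (f k x - f k₀ x) * B.piecewise v h₀.1 x ∂μ| ≤ ε / 2 ∧
      Integrable (fun x => (f k x - f k₀ x) * B.piecewise v h₀.1 x) μ := by
    intro v hv hv1
    have hw : AEStronglyMeasurable (B.piecewise v h₀.1) μ :=
      AEStronglyMeasurable.piecewise hB hv.restrict (Lp.aestronglyMeasurable _).restrict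
    have hw1 : ∀ᵐ x ∂μ, |B.piecewise v h₀.1 x| ≤ 1 := by
      filter_upwards [h₀.2] with x hx
      by_cases hxB : x ∈ B <;> simp [hxB, hv1, hx]
    have hwi : Integrable (B.piecewise v h₀.1) μ :=
      (integrable_const (1 : ℝ)).mono' hw hw1
    have hcoe := (memLp_one_iff_integrable.2 hwi).coeFn_toLp
    have hin : (memLp_one_iff_integrable.2 hwi).toLp ∈ X := by
      filter_upwards [hcoe, hw1] with x hx hx1
      rwa [hx]
    have hdist : dist (⟨_, hin⟩ : X) h₀ < r := by
      rw [Subtype.dist_eq, L1.dist_eq_integral_dist]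
      calc ∫ x, dist ((memLp_one_iff_integrable.2 hwi).toLp _ x) (h₀.1 x) ∂μ
          ≤ ∫ x, B.indicator (fun _ => (2 : ℝ)) x ∂μ := by
            refine integral_mono_of_nonneg (Eventually.of_forall fun x => dist_nonneg)
              ((integrable_const _).indicator hB) ?_
            filter_upwards [hcoe, h₀.2] with x hx hx1
            rw [hx, Real.dist_eq]
            by_cases hxB : x ∈ B
            · simp only [Set.piecewise_eq_of_mem _ _ _ hxB, Set.indicator_of_mem hxB]
              have := hv1 x
              rw [abs_le] at *
              constructor <;> linarith
            · simp [hxB]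
        _ = 2 * μ.real B := by
            rw [integral_indicator hB]
            simp [mul_comm]
        _ < r := by linarith
    have := interior_subset (hball hdist) k hk
    refine ⟨?_, hmul hd hw hw1⟩
    rwa [integral_congr_ae (g := fun x => (f k x - f k₀ x) * B.piecewise v h₀.1 x)
      (by filter_upwards [hcoe] with x hx; rw [hx])] at this
  have hsgn : Measurable (fun y : ℝ => if 0 ≤ y then (1 : ℝ) else -1) :=
    Measurable.ite measurableSet_Ici measurable_const measurable_const
  obtain ⟨h1, i1⟩ := hmem (fun x => if 0 ≤ f k x - f k₀ x then (1 : ℝ) else -1)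
    (hsgn.comp_aemeasurable hd.aemeasurable).aestronglyMeasurable
    (fun x => by split_ifs <;> simp)
  obtain ⟨h2, i2⟩ := hmem (fun _ => 0) aestronglyMeasurable_const (fun x => by simp)
  have : ∫ x in B, |f k x - f k₀ x| ∂μ =
      ∫ x, (f k x - f k₀ x) * B.piecewise
        (fun x => if 0 ≤ f k x - f k₀ x then (1 : ℝ) else -1) h₀.1 x ∂μ -
      ∫ x, (f k x - f k₀ x) * B.piecewise (fun _ => 0) h₀.1 x ∂μ := by
    rw [← integral_sub i1 i2, ← integral_indicator hB]
    congr 1 with x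
    by_cases hxB : x ∈ B
    · simp only [Set.indicator_of_mem hxB, Set.piecewise_eq_of_mem _ _ _ hxB]
      split_ifs with hx
      · rw [abs_of_nonneg hx]; ring
      · rw [abs_of_neg (not_le.1 hx)]; ring
    · simp [hxB]
  rw [this]
  rw [abs_le] at h1 h2
  linarith

theorem exists_subseq_forall_tendsto {ι : Type*} [Countable ι] {a : ℕ → ι → ℝ} {M : ι → ℝ}
    (h : ∀ n i, |a n i| ≤ M i) :
    ∃ nk : ℕ → ℕ, StrictMono nk ∧ ∃ L : ι → ℝ, ∀ i,
      Tendsto (fun k => a (nk k) i) atTop (nhds (L i)) := by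
  obtain ⟨L, nk, hnk, hL⟩ := CompactSpace.tendsto_subseq
    (X := ∀ i, Set.Icc (-M i) (M i)) fun n i => ⟨a n i, abs_le.1 (h n i)⟩
  exact ⟨nk, hnk, fun i => L i, fun i =>
    (continuous_subtype_val.tendsto _).comp (tendsto_pi_nhds.1 hL i)⟩

theorem exists_tendsto_intervalIntegral_of_rat {f : ℕ → ℝ → ℝ}
    (hf : ∀ n T, IntegrableOn (f n) (Set.Ioc 0 T))
    (hE : ∀ T, EquiAbsCont (volume.restrict (Set.Ioc (0 : ℝ) T)) f)
    (hq : ∀ q : ℚ, ∃ L, Tendsto (fun n => ∫ x in Set.Ioc (0 : ℝ) q, f n x) atTop (nhds L))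
    (t : ℝ) : ∃ L, Tendsto (fun n => ∫ x in Set.Ioc (0 : ℝ) t, f n x) atTop (nhds L) := by
  apply cauchySeq_tendsto_of_complete
  rw [Metric.cauchySeq_iff']
  intro ε hε
  obtain ⟨δ, hδ, hδf⟩ := hE (t + 1) (ε / 4) (by positivity)
  obtain ⟨q, htq, hqt⟩ := exists_rat_btwn (show t < t + min δ 1 by simp [hδ])
  have hclose : ∀ n, |(∫ x in Set.Ioc (0 : ℝ) q, f n x) - ∫ x in Set.Ioc (0 : ℝ) t, f n x|
      ≤ ε / 4 := by
    intro n
    have hsub : Set.Ioc 0 t ⊆ Set.Ioc (0 : ℝ) q := Set.Ioc_subset_Ioc_right htq.le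
    have hA : Set.Ioc (0 : ℝ) q \ Set.Ioc 0 t ⊆ Set.Ioc t q := fun x hx => by
      refine ⟨lt_of_not_ge fun h => hx.2 ⟨hx.1.1, h⟩, hx.1.2⟩
    have hA' : Set.Ioc (0 : ℝ) q \ Set.Ioc 0 t ⊆ Set.Ioc 0 (t + 1) := fun x hx =>
      ⟨hx.1.1, hx.1.2.trans (hqt.le.trans (by gcongr; exact min_le_right _ _))⟩
    have hm : MeasurableSet (Set.Ioc (0 : ℝ) q \ Set.Ioc 0 t) :=
      measurableSet_Ioc.diff measurableSet_Ioc
    rw [← setIntegral_sdiff measurableSet_Ioc (hf n q) hsub]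
    refine abs_integral_le_integral_abs.trans ?_
    have := hδf n _ hm ?_
    · rwa [Measure.restrict_restrict hm, Set.inter_eq_left.2 hA'] at this
    · rw [measureReal_restrict_apply hm, Set.inter_eq_left.2 hA']
      refine (measureReal_mono hA (by simp)).trans ?_
      rw [Real.volume_real_Ioc_of_le htq.le]
      linarith [min_le_left δ 1]
  obtain ⟨L, hL⟩ := hq q
  obtain ⟨N, hN⟩ := Metric.cauchySeq_iff'.1 hL.cauchySeq (ε / 4) (by positivity)
  refine ⟨N, fun n hn => ?_⟩
  have h1 := hN n hn
  have h2 := hclose n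
  have h3 := hclose N
  rw [Real.dist_eq, abs_lt] at *
  rw [abs_le] at h2 h3
  constructor <;> linarith

theorem setIntegral_Ioc_sub_abs_le {f : ℝ → ℝ} {T a b : ℝ}
    (hf : IntegrableOn f (Set.Ioc 0 T)) (ha : a ∈ Set.Icc 0 T) (hb : b ∈ Set.Icc 0 T) :
    |(∫ x in Set.Ioc 0 a, f x) - ∫ x in Set.Ioc 0 b, f x| ≤ ∫ x in Set.uIoc a b, |f x| := by
  have hi : ∀ c ∈ Set.Icc 0 T, IntervalIntegrable f volume 0 c := fun c hc =>
    (intervalIntegrable_iff_integrableOn_Ioc_of_le hc.1).2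
      (hf.mono_set (Set.Ioc_subset_Ioc_right hc.2))
  rw [← intervalIntegral.integral_of_le ha.1, ← intervalIntegral.integral_of_le hb.1,
    intervalIntegral.integral_interval_sub_left (hi a ha) (hi b hb), Set.uIoc_comm]
  simpa only [Real.norm_eq_abs] using
    intervalIntegral.norm_integral_le_integral_norm_uIoc (f := f) (μ := volume) (a := b) (b := a)

theorem absolutelyContinuousOnInterval_of_tendsto {f : ℕ → ℝ → ℝ} {T : ℝ} (hT : 0 ≤ T)
    (hf : ∀ n, IntegrableOn (f n) (Set.Ioc 0 T))
    (hE : EquiAbsCont (volume.restrict (Set.Ioc (0 : ℝ) T)) f) {F : ℝ → ℝ}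
    (hF : ∀ t, Tendsto (fun n => ∫ x in Set.Ioc (0 : ℝ) t, f n x) atTop (nhds (F t))) :
    AbsolutelyContinuousOnInterval F 0 T := by
  rw [absolutelyContinuousOnInterval_iff]
  intro ε hε
  obtain ⟨δ, hδ, hδf⟩ := hE (ε / 2) (by positivity)
  refine ⟨δ, hδ, fun ⟨n, I⟩ hI hsum => ?_⟩
  have hsub := AbsolutelyContinuousOnInterval.biUnion_uIoc_subset_of_mem_disjWithin hI
  rw [Set.uIoc_of_le hT] at hsub
  have hm : MeasurableSet (⋃ i ∈ Finset.range n, Set.uIoc (I i).1 (I i).2) :=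
    Finset.measurableSet_biUnion _ fun i _ => measurableSet_uIoc
  refine lt_of_le_of_lt (b := ε / 2) ?_ (by linarith)
  refine le_of_tendsto (tendsto_finsetSum (Finset.range n) fun i _ =>
    (hF (I i).1).dist (hF (I i).2)) (Eventually.of_forall fun k => ?_)
  have hA := hδf k _ hm ?_
  · rw [Measure.restrict_restrict hm, Set.inter_eq_left.2 hsub, integral_biUnion_finset _
      (fun i _ => measurableSet_uIoc) hI.2 fun i hi => IntegrableOn.mono_set (hf k).abs
        ((Set.subset_biUnion_of_mem (u := fun i => Set.uIoc (I i).1 (I i).2) hi).trans hsub)] at hA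
    refine (Finset.sum_le_sum fun i hi => ?_).trans hA
    have h := hI.1 i hi
    rw [Set.uIcc_of_le hT] at h
    exact setIntegral_Ioc_sub_abs_le (hf k) h.1 h.2
  · rw [measureReal_restrict_apply hm, Set.inter_eq_left.2 hsub]
    refine (measureReal_biUnion_finset_le _ _).trans (le_trans (le_of_eq ?_) hsum.le)
    refine Finset.sum_congr rfl fun i _ => ?_
    rw [Set.uIoc, Real.volume_real_Ioc_of_le min_le_max, max_sub_min_eq_abs', Real.dist_eq]

theorem EquiAbsCont.comp {α ι κ : Type*} [MeasurableSpace α] {μ : Measure α} {f : ι → α → ℝ}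
    (h : EquiAbsCont μ f) (e : κ → ι) : EquiAbsCont μ fun k => f (e k) := fun ε hε => by
  obtain ⟨δ, hδ, hd⟩ := h ε hε
  exact ⟨δ, hδ, fun i => hd (e i)⟩

/-- Sequential Dunford–Pettis criterion on the half-line. -/
theorem exists_subseq_weakly_tendsto {f : ℕ → ℝ → ℝ}
    (hf : ∀ n T, IntegrableOn (f n) (Set.Ioc 0 T))
    (hE : ∀ T, EquiAbsCont (volume.restrict (Set.Ioc (0 : ℝ) T)) f)
    (hM : ∀ T, ∃ M, ∀ n, ∫ x in Set.Ioc (0 : ℝ) T, |f n x| ≤ M) :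
    ∃ (nk : ℕ → ℕ) (g : ℝ → ℝ), StrictMono nk ∧ (∀ T, IntegrableOn g (Set.Ioc 0 T)) ∧
      ∀ T, ∀ ψ : ℝ → ℝ, Measurable ψ → (∃ C : ℝ, ∀ x, |ψ x| ≤ C) →
        Tendsto (fun k => ∫ x in Set.Ioc (0 : ℝ) T, f (nk k) x * ψ x) atTop
          (nhds (∫ x in Set.Ioc (0 : ℝ) T, g x * ψ x)) := by
  choose M hM using hM
  obtain ⟨nk, hnk, L, hL⟩ := exists_subseq_forall_tendsto
    (a := fun n (q : ℚ) => ∫ x in Set.Ioc (0 : ℝ) q, f n x) (M := fun q => M q)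
    fun n q => abs_integral_le_integral_abs.trans (hM q n)
  choose F hF using exists_tendsto_intervalIntegral_of_rat (f := fun k => f (nk k))
    (fun k => hf (nk k)) (fun T => (hE T).comp nk) fun q => ⟨L q, hL q⟩
  have hac : ∀ T, 0 ≤ T → AbsolutelyContinuousOnInterval F 0 T := fun T hT =>
    absolutelyContinuousOnInterval_of_tendsto hT (fun k => hf (nk k) T) ((hE T).comp nk) hF
  have hg : ∀ T, IntegrableOn (deriv F) (Set.Ioc 0 T) := fun T => by
    rcases le_total 0 T with hT | hT
    · exact (intervalIntegrable_iff_integrableOn_Ioc_of_le hT).1 (hac T hT).intervalIntegrable_deriv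
    · simp [Set.Ioc_eq_empty_of_le hT]
  have hF0 : F 0 = 0 := tendsto_nhds_unique (hF 0) (by simp)
  have hFg : ∀ t, Tendsto (fun k => ∫ x in Set.Ioc (0 : ℝ) t, f (nk k) x) atTop
      (nhds (∫ x in Set.Ioc (0 : ℝ) t, deriv F x)) := fun t => by
    rcases le_total 0 t with ht | ht
    · rw [← intervalIntegral.integral_of_le ht, (hac t ht).integral_deriv_eq_sub, hF0, sub_zero]
      exact hF t
    · simp [Set.Ioc_eq_empty_of_le ht]
  refine ⟨nk, deriv F, hnk, hg, fun T ψ hψ ⟨C, hC⟩ => ?_⟩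
  refine tendsto_integral_mul_of_tendsto_setIntegral (fun k => hf (nk k) T) (hg T)
    (fun k => hM T (nk k)) (fun A hA => ?_) hψ hC
  refine ((hE T).comp nk).tendsto_setIntegral_of_generateFrom (fun k => hf (nk k) T) (hg T)
    (S := Set.range Set.Iic) ?_ isPiSystem_Iic (hFg T) ?_ hA
  · exact (BorelSpace.measurable_eq (α := ℝ)).trans (borel_eq_generateFrom_Iic ℝ)
  · rintro _ ⟨a, rfl⟩
    simp only [Measure.restrict_restrict measurableSet_Iic, Set.inter_comm (Set.Iic a),
      Set.Ioc_inter_Iic]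
    exact hFg _

theorem integrableOn_comp_add {φ : ℝ → ℝ} (hloc : ∀ T > (0 : ℝ), IntervalIntegrable φ volume 0 T)
    {τ : ℝ} (hτ : 0 ≤ τ) (T : ℝ) : IntegrableOn (fun x => φ (x + τ)) (Set.Ioc 0 T) := by
  rcases le_total T 0 with hT | hT
  · simp [Set.Ioc_eq_empty_of_le hT]
  have h := (hloc (T + τ + 1) (by linarith)).mono_set (c := 0 + τ) (d := T + τ) (by
    rw [Set.uIcc_of_le (by linarith), Set.uIcc_of_le (by linarith)]
    exact Set.Icc_subset_Icc (by linarith) (by linarith))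
  have := h.comp_add_right τ
  simp only [add_sub_cancel_right] at this
  exact (intervalIntegrable_iff_integrableOn_Ioc_of_le hT).1 this

theorem setIntegral_tail_comp_add_le {φ : ℝ → ℝ}
    (hloc : ∀ T > (0 : ℝ), IntervalIntegrable φ volume 0 T) {K ε : ℝ}
    (h : ∀ t : ℝ, 0 ≤ t → (∫ s in t..(t + 1), (if K ≤ |φ s| then |φ s| else 0)) ≤ ε)
    {τ : ℝ} (hτ : 0 ≤ τ) (T : ℝ) :
    ∫ x in Set.Ioc 0 T, (if K ≤ |φ (x + τ)| then |φ (x + τ)| else 0) ≤ ⌈T⌉₊ * ε := by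
  have hint : ∀ T, IntegrableOn (fun x => if K ≤ |φ (x + τ)| then |φ (x + τ)| else 0)
      (Set.Ioc 0 T) := fun T => integrable_ite_le_abs (integrableOn_comp_add hloc hτ T) K
  calc ∫ x in Set.Ioc 0 T, (if K ≤ |φ (x + τ)| then |φ (x + τ)| else 0)
      ≤ ∫ x in Set.Ioc 0 (⌈T⌉₊ : ℝ), (if K ≤ |φ (x + τ)| then |φ (x + τ)| else 0) := by
        refine setIntegral_mono_set (hint _) (Eventually.of_forall fun x => ?_)
          (Set.Ioc_subset_Ioc_right (Nat.le_ceil T)).eventuallyLE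
        dsimp only
        split_ifs <;> simp
    _ = ∑ i ∈ Finset.range ⌈T⌉₊, ∫ x in (i : ℝ)..((i + 1 : ℕ) : ℝ),
          (if K ≤ |φ (x + τ)| then |φ (x + τ)| else 0) := by
        rw [intervalIntegral.sum_integral_adjacent_intervals (a := fun i : ℕ => (i : ℝ)),
          Nat.cast_zero, intervalIntegral.integral_of_le (Nat.cast_nonneg _)]
        intro k _
        rw [intervalIntegrable_iff_integrableOn_Ioc_of_le (by simp)]
        exact (hint _).mono_set (Set.Ioc_subset_Ioc_left (Nat.cast_nonneg k))
    _ ≤ ∑ i ∈ Finset.range ⌈T⌉₊, ε := by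
        refine Finset.sum_le_sum fun i _ => ?_
        rw [intervalIntegral.integral_comp_add_right
          (fun x => if K ≤ |φ x| then |φ x| else 0) τ]
        rw [show ((i + 1 : ℕ) : ℝ) + τ = i + τ + 1 by push_cast; ring]
        exact h (i + τ) (by positivity)
    _ = ⌈T⌉₊ * ε := by simp

theorem TransUnifInt.exists_tail_le {φ : ℝ → ℝ} (h : TransUnifInt φ)
    (hloc : ∀ T > (0 : ℝ), IntervalIntegrable φ volume 0 T) (T : ℝ) {ε : ℝ} (hε : 0 < ε) :
    ∃ K ≥ (0 : ℝ), ∀ τ : Set.Ici (0 : ℝ),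
      ∫ x in Set.Ioc 0 T, (if K ≤ |φ (x + τ)| then |φ (x + τ)| else 0) ≤ ε := by
  obtain ⟨K₀, hK₀⟩ := h (ε / (⌈T⌉₊ + 1)) (by positivity)
  refine ⟨max K₀ 0, le_max_right _ _, fun τ => ?_⟩
  refine (setIntegral_tail_comp_add_le hloc (hK₀ _ (le_max_left _ _)) τ.2 T).trans ?_
  have h1 : (⌈T⌉₊ : ℝ) * (ε / (⌈T⌉₊ + 1)) ≤ (⌈T⌉₊ + 1) * (ε / (⌈T⌉₊ + 1)) := by
    gcongr
    linarith
  rwa [mul_div_cancel₀ _ (by positivity)] at h1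

theorem exists_integral_abs_le_of_cauchySeq {f : ℕ → ℝ → ℝ}
    (hf : ∀ n, IntegrableOn (f n) (Set.Ioc 0 1)) {k₀ : ℕ} {δ : ℝ} (hδ : 0 < δ)
    (h : ∀ k ≥ k₀, ∀ B, MeasurableSet B → (volume.restrict (Set.Ioc (0 : ℝ) 1)).real B ≤ δ →
      ∫ x in B, |f k x - f k₀ x| ∂(volume.restrict (Set.Ioc (0 : ℝ) 1)) ≤ 1) :
    ∃ M, ∀ k ≥ k₀, ∫ x in Set.Ioc (0 : ℝ) 1, |f k x - f k₀ x| ≤ M := by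
  obtain ⟨n, hn⟩ := exists_nat_one_div_lt hδ
  refine ⟨(n + 1 : ℕ), fun k hk => ?_⟩
  have hn0 : (0 : ℝ) < (n : ℝ) + 1 := by positivity
  have hmono : ∀ i : ℕ, (i : ℝ) / (n + 1) ≤ ((i + 1 : ℕ) : ℝ) / (n + 1) := fun i => by
    gcongr
    simp
  have hsub : ∀ i < n + 1, Set.Ioc ((i : ℝ) / (n + 1)) (((i + 1 : ℕ) : ℝ) / (n + 1)) ⊆
      Set.Ioc 0 1 := fun i hi => by
    refine Set.Ioc_subset_Ioc (by positivity) ((div_le_one hn0).2 ?_)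
    exact_mod_cast hi
  have hd : IntegrableOn (fun x => |f k x - f k₀ x|) (Set.Ioc 0 1) := ((hf k).sub (hf k₀)).abs
  have hsum := intervalIntegral.sum_integral_adjacent_intervals (μ := volume)
    (f := fun x => |f k x - f k₀ x|) (a := fun i : ℕ => (i : ℝ) / (n + 1)) (n := n + 1)
    fun i hi => (intervalIntegrable_iff_integrableOn_Ioc_of_le (hmono i)).2
      (hd.mono_set (hsub i hi))
  simp only [Nat.cast_zero, zero_div] at hsum
  rw [show (((n + 1 : ℕ) : ℝ) / (n + 1)) = 1 by push_cast; exact div_self hn0.ne',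
    intervalIntegral.integral_of_le zero_le_one] at hsum
  rw [← hsum]
  refine (Finset.sum_le_card_nsmul _ _ 1 fun i hi => ?_).trans (by simp)
  have hi' := hsub i (Finset.mem_range.1 hi)
  rw [intervalIntegral.integral_of_le (hmono i)]
  have := h k hk _ (measurableSet_Ioc (a := (i : ℝ) / (n + 1))
    (b := ((i + 1 : ℕ) : ℝ) / (n + 1))) ?_
  · rwa [Measure.restrict_restrict measurableSet_Ioc, Set.inter_eq_left.2 hi'] at this
  · rw [measureReal_restrict_apply measurableSet_Ioc, Set.inter_eq_left.2 hi',
      Real.volume_real_Ioc_of_le (hmono i)]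
    refine le_trans (le_of_eq ?_) hn.le
    push_cast
    ring

theorem exists_tail_lt_of_cauchySeq {f : ℕ → ℝ → ℝ}
    (hf : ∀ n, IntegrableOn (f n) (Set.Ioc 0 1))
    (hc : ∀ ψ : ℝ → ℝ, Measurable ψ → (∀ x, |ψ x| ≤ 1) →
      CauchySeq fun n => ∫ x in Set.Ioc (0 : ℝ) 1, f n x * ψ x) {ε : ℝ} (hε : 0 < ε) :
    ∃ k₀ : ℕ, ∃ K₀ : ℝ, ∀ k ≥ k₀, ∀ K ≥ K₀,
      ∫ x in Set.Ioc (0 : ℝ) 1, (if K ≤ |f k x| then |f k x| else 0) ≤ ε := by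
  obtain ⟨k₁, δ₁, hδ₁, h₁⟩ := exists_equiAbsCont_tail_of_cauchySeq hf hc one_pos
  obtain ⟨M, hM⟩ := exists_integral_abs_le_of_cauchySeq hf hδ₁ h₁
  obtain ⟨k₂, δ₂, hδ₂, h₂⟩ := exists_equiAbsCont_tail_of_cauchySeq hf hc (half_pos hε)
  obtain ⟨δ₃, hδ₃, h₃⟩ := exists_forall_setIntegral_abs_le (hf k₂) (half_pos hε)
  have htri : ∀ j k, ∀ B : Set ℝ, ∫ x in B, |f k x| ∂(volume.restrict (Set.Ioc (0 : ℝ) 1)) ≤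
      ∫ x in B, |f k x - f j x| ∂(volume.restrict (Set.Ioc (0 : ℝ) 1)) +
        ∫ x in B, |f j x| ∂(volume.restrict (Set.Ioc (0 : ℝ) 1)) := fun j k B => by
    have hd : Integrable (fun x => |f k x - f j x|) (volume.restrict (Set.Ioc 0 1)) :=
      ((hf k).sub (hf j)).abs
    rw [← integral_add hd.integrableOn (hf j).abs.integrableOn]
    refine integral_mono (hf k).abs.integrableOn
      (hd.integrableOn.add (hf j).abs.integrableOn) fun x => ?_
    simpa using abs_add_le (f k x - f j x) (f j x)
  set M' := M + ∫ x in Set.Ioc (0 : ℝ) 1, |f k₁ x| with hM'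
  set δ := min δ₂ δ₃ with hδ
  have hδ0 : 0 < δ := lt_min hδ₂ hδ₃
  refine ⟨max k₁ k₂, max 1 (M' / δ), fun k hk K hK => ?_⟩
  have hK0 : 0 < K := one_pos.trans_le ((le_max_left _ _).trans hK)
  have hbound : ∫ x in Set.Ioc (0 : ℝ) 1, |f k x| ≤ M' := by
    have h := htri k₁ k Set.univ
    simp only [Measure.restrict_univ] at h
    linarith [hM k ((le_max_left _ _).trans hk)]
  have hB : NullMeasurableSet {x | K ≤ |f k x|} (volume.restrict (Set.Ioc (0 : ℝ) 1)) :=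
    nullMeasurableSet_le aemeasurable_const (hf k).abs.aemeasurable
  set B := toMeasurable (volume.restrict (Set.Ioc (0 : ℝ) 1)) {x | K ≤ |f k x|} with hBdef
  have hBm : (volume.restrict (Set.Ioc (0 : ℝ) 1)).real B ≤ δ := by
    have h := mul_meas_ge_le_integral_of_nonneg (Eventually.of_forall fun x => abs_nonneg (f k x))
      (hf k).abs K
    rw [measureReal_def, hBdef, measure_toMeasurable, ← measureReal_def]
    refine le_of_mul_le_mul_left (h.trans (hbound.trans ?_)) hK0
    rw [← div_le_iff₀ hδ0]
    exact (le_max_right _ _).trans hK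
  have hind : ∀ x, (if K ≤ |f k x| then |f k x| else 0) =
      Set.indicator {x | K ≤ |f k x|} (fun x => |f k x|) x := fun x => by
    simp [Set.indicator_apply]
  simp only [hind]
  rw [integral_indicator₀ hB, ← setIntegral_congr_set hB.toMeasurable_ae_eq]
  have e1 := h₂ k ((le_max_right _ _).trans hk) B (measurableSet_toMeasurable _ _)
    (hBm.trans (min_le_left _ _))
  have e2 := h₃ B (measurableSet_toMeasurable _ _) (hBm.trans (min_le_right _ _))
  linarith [htri k₂ k B]

/-- Dunford–Pettis characterization: a locally integrable `φ` is translation uniform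
integrable in `L¹_loc([0,∞))` iff from every sequence of nonnegative shifts one can extract a
subsequence whose translates converge weakly in `L¹_loc([0,∞))` to some locally integrable
function. -/
theorem tui_iff_weak_compactness_of_shifts
    (φ : ℝ → ℝ)
    (hloc : ∀ T > (0 : ℝ), IntervalIntegrable φ volume 0 T) :
    TransUnifInt φ ↔
      ∀ τ : ℕ → ℝ, (∀ n, 0 ≤ τ n) →
        ∃ (nk : ℕ → ℕ) (g : ℝ → ℝ), StrictMono nk ∧
          (∀ T > (0 : ℝ), IntervalIntegrable g volume 0 T) ∧
          (∀ T > (0 : ℝ), ∀ ψ : ℝ → ℝ, Measurable ψ →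
            (∃ C : ℝ, ∀ t ∈ Set.Icc (0 : ℝ) T, |ψ t| ≤ C) →
            Tendsto (fun k => ∫ t in (0 : ℝ)..T, φ (t + τ (nk k)) * ψ t) atTop
              (nhds (∫ t in (0 : ℝ)..T, g t * ψ t))) := by
  constructor
  · intro h τ hτ
    have hint : ∀ n T, IntegrableOn (fun x => φ (x + τ n)) (Set.Ioc 0 T) := fun n T =>
      integrableOn_comp_add hloc (hτ n) T
    obtain ⟨nk, g, hnk, hg, hlim⟩ := exists_subseq_weakly_tendsto (f := fun n x => φ (x + τ n))
      hint
      (fun T => (equiAbsCont_of_tail_le (f := fun (s : Set.Ici (0 : ℝ)) x => φ (x + s))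
        (fun s => integrableOn_comp_add hloc s.2 T)
        fun ε hε => h.exists_tail_le hloc T hε).comp fun n => ⟨τ n, hτ n⟩)
      fun T => by
        obtain ⟨K, hK, hKt⟩ := h.exists_tail_le hloc T one_pos
        refine ⟨1 + K * (volume.restrict (Set.Ioc (0 : ℝ) T)).real Set.univ, fun n => ?_⟩
        have := setIntegral_abs_le_of_tail_le (hint n T) hK (hKt ⟨τ n, hτ n⟩) Set.univ
        rwa [Measure.restrict_univ] at this
    refine ⟨nk, g, hnk, fun T hT =>
      (intervalIntegrable_iff_integrableOn_Ioc_of_le hT.le).2 (hg T), ?_⟩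
    rintro T hT ψ hψ ⟨C, hC⟩
    have := hlim T ((Set.Icc 0 T).indicator ψ) (hψ.indicator measurableSet_Icc)
      ⟨max C 0, fun x => by
        by_cases hx : x ∈ Set.Icc 0 T
        · simpa [Set.indicator_of_mem hx] using Or.inl (hC x hx)
        · simp [Set.indicator_of_notMem hx]⟩
    have heq : ∀ u : ℝ → ℝ, ∫ x in Set.Ioc 0 T, u x * (Set.Icc 0 T).indicator ψ x =
        ∫ x in (0 : ℝ)..T, u x * ψ x := fun u => by
      rw [intervalIntegral.integral_of_le hT.le]
      refine setIntegral_congr_fun measurableSet_Ioc fun x hx => ?_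
      simp [Set.indicator_of_mem (Set.Ioc_subset_Icc_self hx)]
    rw [← heq]
    simpa only [← heq] using this
  · intro h
    by_contra hn
    unfold TransUnifInt at hn
    push Not at hn
    obtain ⟨ε, hε, hK⟩ := hn
    choose K hKn τ hτ hτε using fun n : ℕ => hK n
    obtain ⟨nk, g, hnk, -, hlim⟩ := h τ hτ
    obtain ⟨k₀, K₀, hk⟩ := exists_tail_lt_of_cauchySeq (f := fun k x => φ (x + τ (nk k)))
      (fun k => integrableOn_comp_add hloc (hτ _) 1) (fun ψ hψ hb => by
        have := (hlim 1 one_pos ψ hψ ⟨1, fun t _ => hb t⟩).cauchySeq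
        simpa only [intervalIntegral.integral_of_le zero_le_one] using this) hε
    obtain ⟨k₁, hk₁⟩ := exists_nat_ge K₀
    have h1 := hk (max k₀ k₁) (le_max_left _ _) (K (nk (max k₀ k₁))) (hk₁.trans (le_trans
      (by exact_mod_cast (le_max_right _ _).trans (hnk.id_le _)) (hKn _)))
    have h2 := hτε (nk (max k₀ k₁))
    rw [← intervalIntegral.integral_of_le zero_le_one, intervalIntegral.integral_comp_add_right
      (fun x => if K (nk (max k₀ k₁)) ≤ |φ x| then |φ x| else 0), zero_add, add_comm 1] at h1
    linarith
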